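/- arXiv:2305.04071 — 3 statements merged into one kernel-verified Lean document; each statement's English description precedes it below -/
import Mathlib

section
/- Let σ < 0, y₀ ∈ ℝ, and let ε : [y₀, ∞) → ℂ be continuous with ∫_{y₀}^∞ |ε(y)| dy < ∞. Then there exist solutions W₊ and W₋ of the equation U''(y) = ((σ − i)² + ε(y)) U(y) on [y₀, ∞) such that W₊(y) e^((i−σ)y) → 1 and W₊'(y) e^((i−σ)y) → σ − i as y → ∞, and W₋(y) e^((σ−i)y) → 1 and W₋'(y) e^((σ−i)y) → −σ + i as y → ∞; moreover every solution of this equation on [y₀, ∞) is of the form A W₊ + B W₋ with A, B ∈ ℂ. -/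
open MeasureTheory Set Filter Topology

noncomputable section

/-- The wave speed profile `c(x) = (1 + θ (x₊)^α)^(-1/2)`. -/
def spd (α θ x : ℝ) : ℝ := (1 + θ * (max x 0) ^ α) ^ (-(1 / 2) : ℝ)

/-- The WKB amplitude `b(x) = c(x)^(1/2)`. -/
def amp (α θ x : ℝ) : ℝ := spd α θ x ^ ((1 : ℝ) / 2)

/-- The WKB phase `φ(x) = ∫₀ˣ c(y)⁻¹ dy`. -/
def phase (α θ x : ℝ) : ℝ := ∫ y in (0:ℝ)..x, (spd α θ y)⁻¹

/-- `M(x) = c(x)^(1/2) (c^(1/2))''(x)` for `x > 0`, and `0` for `x ≤ 0`. -/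
def Mfun (α θ x : ℝ) : ℝ :=
  if 0 < x then
    spd α θ x ^ ((1 : ℝ) / 2) * deriv (deriv (fun y => spd α θ y ^ ((1 : ℝ) / 2))) x
  else 0

/-- `M_{x₀} = ∫_{x₀}^∞ |M(x)| dx`. -/
def Mtail (α θ x₀ : ℝ) : ℝ := ∫ x in Ioi x₀, |Mfun α θ x|

/-- The Volterra operator `K_σ`. -/
def Kop (α θ x₀ σ : ℝ) (f : ℝ → ℂ) (x : ℝ) : ℂ :=
  (2 * Complex.I * (1 + Complex.I * (σ : ℂ)))⁻¹ *
    ((∫ y in x₀..x, (Mfun α θ y : ℂ) * f y *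
        Complex.exp (-2 * Complex.I * (1 + Complex.I * (σ : ℂ)) *
          ((phase α θ x - phase α θ y : ℝ) : ℂ))) +
      ∫ y in Ioi x, (Mfun α θ y : ℂ) * f y)

/-- The right-going WKB wave `v^> = b e^{-iφ}`. -/
def vplus (α θ x : ℝ) : ℂ := (amp α θ x : ℂ) * Complex.exp (-Complex.I * (phase α θ x : ℂ))

/-- The left-going WKB wave `v^< = b e^{iφ}`. -/
def vminus (α θ x : ℝ) : ℂ := (amp α θ x : ℂ) * Complex.exp (Complex.I * (phase α θ x : ℂ))

/-- `S` is a bounded continuous solution on `[x₀,∞)` of `S = e^{-2iφ} + K₀ S`. -/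
def IsVolterraSol (α θ x₀ : ℝ) (S : ℝ → ℂ) : Prop :=
  (∃ C, ∀ x ∈ Ici x₀, ‖S x‖ ≤ C) ∧ ContinuousOn S (Ici x₀) ∧
    ∀ x ∈ Ici x₀, S x = Complex.exp (-2 * Complex.I * (phase α θ x : ℂ)) + Kop α θ x₀ 0 S x

/-- `R_{x₀} = (2i)⁻¹ ∫_{x₀}^∞ M S^>`. -/
def Rx (α θ x₀ : ℝ) (S : ℝ → ℂ) : ℂ :=
  (2 * Complex.I)⁻¹ * ∫ x in Ioi x₀, (Mfun α θ x : ℂ) * S x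

open scoped BoundedContinuousFunction

section Volterra

variable {κ : ℂ} {φ : ℝ → ℂ}

theorem integral_Iic_eq_add_intervalIntegral {E : Type*} [NormedAddCommGroup E] [NormedSpace ℝ E]
    {F : ℝ → E} (hF : ∀ y, IntegrableOn F (Iic y)) (a y : ℝ) :
    ∫ s in Iic y, F s = (∫ s in Iic a, F s) + ∫ s in a..y, F s := by
  rw [← intervalIntegral.integral_Iic_sub_Iic (hF a) (hF y)]
  abel

theorem continuous_integral_Iic {E : Type*} [NormedAddCommGroup E] [NormedSpace ℝ E]
    {F : ℝ → E} (hF : ∀ y, IntegrableOn F (Iic y)) :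
    Continuous fun y => ∫ s in Iic y, F s := by
  rw [funext (integral_Iic_eq_add_intervalIntegral hF 0)]
  refine continuous_const.add (intervalIntegral.continuous_primitive (fun a b => ?_) 0)
  exact ⟨(hF b).mono_set fun _ hx => hx.2, (hF a).mono_set fun _ hx => hx.2⟩

theorem hasDerivAt_integral_Iic {E : Type*} [NormedAddCommGroup E] [NormedSpace ℝ E]
    [CompleteSpace E] {F : ℝ → E} (hF : ∀ y, IntegrableOn F (Iic y)) (hc : Continuous F) (y : ℝ) :
    HasDerivAt (fun y => ∫ s in Iic y, F s) (F y) y := by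
  rw [funext (integral_Iic_eq_add_intervalIntegral hF 0)]
  exact (hc.integral_hasStrictDerivAt 0 y).hasDerivAt.const_add _

theorem integrableOn_exp_neg_mul (hκ : κ.re ≤ 0) (hφ : Integrable φ) (y : ℝ) :
    IntegrableOn (fun s : ℝ => Complex.exp (-κ * s) * φ s) (Iic y) := by
  refine Integrable.bdd_mul (c := Real.exp (-κ.re * y)) hφ.integrableOn
    (by fun_prop : Continuous fun s : ℝ => Complex.exp (-κ * s)).aestronglyMeasurable ?_
  filter_upwards [ae_restrict_mem measurableSet_Iic] with s hs
  rw [Complex.norm_exp]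
  simp only [Complex.mul_re, Complex.neg_re, Complex.ofReal_re, Complex.ofReal_im, mul_zero,
    sub_zero]
  exact Real.exp_le_exp.2 (mul_le_mul_of_nonneg_left hs (by linarith))

/-- The Volterra operator `∫_{-∞}^y e^{κ (y - s)} φ(s) ds`. -/
def expVolterra (κ : ℂ) (φ : ℝ → ℂ) (y : ℝ) : ℂ :=
  Complex.exp (κ * y) * ∫ s in Iic y, Complex.exp (-κ * s) * φ s

theorem norm_exp_mul_exp_neg_le (hκ : κ.re ≤ 0) {s y : ℝ} (h : s ≤ y) :
    ‖Complex.exp (κ * y) * Complex.exp (-κ * s)‖ ≤ 1 := by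
  rw [← Complex.exp_add, Complex.norm_exp, Real.exp_le_one_iff]
  simp only [Complex.add_re, Complex.mul_re, Complex.neg_re, Complex.ofReal_re, Complex.ofReal_im,
    mul_zero, sub_zero]
  nlinarith

theorem norm_expVolterra_le (hκ : κ.re ≤ 0) (hφ : Integrable φ) (y : ℝ) :
    ‖expVolterra κ φ y‖ ≤ ∫ s in Iic y, ‖φ s‖ := by
  rw [expVolterra, ← integral_const_mul]
  refine norm_integral_le_of_norm_le hφ.norm.integrableOn ?_
  filter_upwards [ae_restrict_mem measurableSet_Iic] with s hs
  rw [← mul_assoc, norm_mul]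
  exact mul_le_of_le_one_left (norm_nonneg _) (norm_exp_mul_exp_neg_le hκ hs)

theorem continuous_expVolterra (hκ : κ.re ≤ 0) (hφ : Integrable φ) :
    Continuous (expVolterra κ φ) :=
  (by fun_prop : Continuous fun y : ℝ => Complex.exp (κ * y)).mul
    (continuous_integral_Iic (integrableOn_exp_neg_mul hκ hφ))

theorem expVolterra_sub (hκ : κ.re ≤ 0) {ψ : ℝ → ℂ} (hφ : Integrable φ) (hψ : Integrable ψ)
    (y : ℝ) : expVolterra κ (fun s => φ s - ψ s) y = expVolterra κ φ y - expVolterra κ ψ y := by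
  simp only [expVolterra, mul_sub]
  rw [integral_sub (integrableOn_exp_neg_mul hκ hφ y) (integrableOn_exp_neg_mul hκ hψ y), mul_sub]

theorem expVolterra_zero (φ : ℝ → ℂ) (y : ℝ) : expVolterra 0 φ y = ∫ s in Iic y, φ s := by
  simp [expVolterra]

theorem tendsto_expVolterra_atBot (hκ : κ.re ≤ 0) (hφ : Integrable φ) :
    Tendsto (expVolterra κ φ) atBot (𝓝 0) :=
  squeeze_zero_norm (norm_expVolterra_le hκ hφ) (tendsto_integral_Iic_zero tendsto_id)

theorem tendsto_exp_mul_atTop (hκ : κ.re < 0) :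
    Tendsto (fun y : ℝ => Complex.exp (κ * y)) atTop (𝓝 0) := by
  rw [tendsto_zero_iff_norm_tendsto_zero]
  simp only [Complex.norm_exp, Complex.mul_re, Complex.ofReal_re, Complex.ofReal_im, mul_zero,
    sub_zero]
  exact Real.tendsto_exp_atBot.comp (tendsto_id.const_mul_atTop_of_neg hκ)

theorem tendsto_expVolterra_atTop (hκ : κ.re < 0) (hφ : Integrable φ) :
    Tendsto (expVolterra κ φ) atTop (𝓝 0) := by
  have key : ∀ y, expVolterra κ φ y =
      ∫ s, (Iic y).indicator
        (fun s : ℝ => Complex.exp (κ * y) * (Complex.exp (-κ * s) * φ s)) s := by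
    intro y
    rw [integral_indicator measurableSet_Iic, integral_const_mul, expVolterra]
  rw [funext key, ← integral_zero ℝ ℂ (μ := volume)]
  refine tendsto_integral_filter_of_dominated_convergence (fun s => ‖φ s‖) ?_ ?_ hφ.norm ?_
  · refine Eventually.of_forall fun y => AEStronglyMeasurable.indicator ?_ measurableSet_Iic
    have h : Continuous fun s : ℝ => Complex.exp (-κ * s) := by fun_prop
    exact (h.aestronglyMeasurable.mul hφ.aestronglyMeasurable).const_mul _
  · refine Eventually.of_forall fun y => Eventually.of_forall fun s => ?_
    by_cases hs : s ∈ Iic y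
    · rw [indicator_of_mem hs, ← mul_assoc, norm_mul]
      exact mul_le_of_le_one_left (norm_nonneg _) (norm_exp_mul_exp_neg_le hκ.le hs)
    · rw [indicator_of_notMem hs, norm_zero]
      exact norm_nonneg _
  · refine Eventually.of_forall fun s => ?_
    have h := (tendsto_exp_mul_atTop hκ).mul_const (Complex.exp (-κ * s) * φ s)
    rw [zero_mul] at h
    refine h.congr' ?_
    filter_upwards [eventually_ge_atTop s] with y hy
    rw [indicator_of_mem (mem_Iic.2 hy)]

theorem integral_Iic_mul_exp {m : ℝ → ℝ} (hm : Continuous m) (hmi : Integrable m)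
    (h0 : ∀ s, 0 ≤ m s) (y : ℝ) :
    Integrable (fun s => m s * Real.exp (4 * ∫ t in Iic s, m t)) ∧
    ∫ s in Iic y, m s * Real.exp (4 * ∫ t in Iic s, m t) =
      (Real.exp (4 * ∫ t in Iic y, m t) - 1) / 4 := by
  have hcont : Continuous fun s => Real.exp (4 * ∫ t in Iic s, m t) :=
    Real.continuous_exp.comp
      (continuous_const.mul (continuous_integral_Iic fun y => hmi.integrableOn))
  have hint : Integrable fun s => m s * Real.exp (4 * ∫ t in Iic s, m t) := by
    refine hmi.mul_bdd (c := Real.exp (4 * ∫ t, m t)) hcont.aestronglyMeasurable ?_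
    refine Eventually.of_forall fun s => ?_
    rw [Real.norm_eq_abs, Real.abs_exp, Real.exp_le_exp]
    have := setIntegral_le_integral (s := Iic s) hmi (Eventually.of_forall h0)
    linarith
  refine ⟨hint, ?_⟩
  have := integral_Iic_of_hasDerivAt_of_tendsto' (a := y) (m := 1 / 4)
    (f := fun s => Real.exp (4 * ∫ t in Iic s, m t) / 4)
    (f' := fun s => m s * Real.exp (4 * ∫ t in Iic s, m t)) ?_ hint.integrableOn ?_
  · rw [this]; ring
  · intro x _
    have h := (((hasDerivAt_integral_Iic (fun y => hmi.integrableOn) hm x).const_mul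
      4).exp).div_const 4
    exact h.congr_deriv (by ring)
  · have h : Tendsto (fun s => ∫ t in Iic s, m t) atBot (𝓝 0) :=
      tendsto_integral_Iic_zero tendsto_id
    simpa using ((Real.continuous_exp.tendsto _).comp (h.const_mul 4)).div_const 4

theorem exists_volterra_solution (hκ : κ.re ≤ 0) {g : ℝ → ℂ} {m : ℝ → ℝ}
    (hg : AEStronglyMeasurable g) (hm : Continuous m) (hmi : Integrable m)
    (hgm : ∀ s, ‖g s‖ ≤ m s) (f : ℝ →ᵇ ℂ) :
    ∃ S : ℝ →ᵇ ℂ, ∀ y, S y = f y + expVolterra κ (fun s => g s * S s) y -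
      ∫ s in Iic y, g s * S s := by
  have h0 : ∀ s, 0 ≤ m s := fun s => (norm_nonneg _).trans (hgm s)
  have hgi : Integrable g := hmi.mono' hg (Eventually.of_forall hgm)
  set H : ℝ → ℝ := fun y => Real.exp (4 * ∫ t in Iic y, m t) with hH
  have hHc : Continuous H := Real.continuous_exp.comp
    (continuous_const.mul (continuous_integral_Iic fun y => hmi.integrableOn))
  have hHpos : ∀ y, 0 < H y := fun y => Real.exp_pos _
  have hH1 : ∀ y, 1 ≤ H y := fun y => Real.one_le_exp
    (mul_nonneg (by norm_num) (integral_nonneg h0))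
  have hHle : ∀ y, H y ≤ Real.exp (4 * ∫ t, m t) := fun y => by
    rw [hH, Real.exp_le_exp]
    have := setIntegral_le_integral (s := Iic y) hmi (Eventually.of_forall h0)
    linarith
  let Hb : ℝ →ᵇ ℂ := BoundedContinuousFunction.ofNormedAddCommGroup (fun y => (H y : ℂ))
    (Complex.continuous_ofReal.comp hHc) (Real.exp (4 * ∫ t, m t)) fun y => by
      rw [Complex.norm_real, Real.norm_of_nonneg (hHpos y).le]; exact hHle y
  have hHb : ∀ y, Hb y = (H y : ℂ) := fun _ => rfl
  have hgb : ∀ R : ℝ →ᵇ ℂ, Integrable fun s => g s * R s := fun R =>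
    hgi.mul_bdd (c := ‖R‖) R.continuous.aestronglyMeasurable
      (Eventually.of_forall R.norm_coe_le_norm)
  let K : (ℝ →ᵇ ℂ) → ℝ → ℂ := fun R y =>
    expVolterra κ (fun s => g s * R s) y - expVolterra 0 (fun s => g s * R s) y
  have hKc : ∀ R, Continuous (K R) := fun R =>
    (continuous_expVolterra hκ (hgb R)).sub (continuous_expVolterra (by simp) (hgb R))
  have hKn : ∀ R y, ‖K R y‖ ≤ 2 * ∫ s in Iic y, ‖g s * R s‖ := fun R y => by
    refine (norm_sub_le _ _).trans ?_
    linarith [norm_expVolterra_le hκ (hgb R) y,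
      norm_expVolterra_le (κ := 0) (by simp) (hgb R) y]
  have hKs : ∀ R Q y, K (R - Q) y = K R y - K Q y := fun R Q y => by
    simp only [K, BoundedContinuousFunction.coe_sub, Pi.sub_apply, mul_sub]
    rw [expVolterra_sub hκ (hgb R) (hgb Q), expVolterra_sub (by simp) (hgb R) (hgb Q)]
    ring
  have hKH : ∀ (R : ℝ →ᵇ ℂ) y, ‖K (Hb * R) y‖ ≤ H y * (‖R‖ / 2) := fun R y => by
    obtain ⟨hi, he⟩ := integral_Iic_mul_exp hm hmi h0 y
    have : ∫ s in Iic y, ‖g s * (Hb * R) s‖ ≤ ∫ s in Iic y, ‖R‖ * (m s * H s) := by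
      refine integral_mono (hgb _).norm.integrableOn (hi.const_mul _).integrableOn ?_
      intro s
      simp only [BoundedContinuousFunction.coe_mul, Pi.mul_apply, norm_mul, hHb, Complex.norm_real,
        Real.norm_of_nonneg (hHpos s).le]
      have h1 := R.norm_coe_le_norm s
      have h2 := hgm s
      have h3 := (hHpos s).le
      calc ‖g s‖ * (H s * ‖R s‖) ≤ m s * (H s * ‖R‖) := by gcongr; exact h0 s
        _ = _ := by ring
    rw [integral_const_mul, he] at this
    have h4 := hKn (Hb * R) y
    have h5 := norm_nonneg R
    change _ ≤ ‖R‖ * ((H y - 1) / 4) at this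
    linarith
  have hinv : ∀ y, ‖((H y : ℂ))⁻¹‖ = (H y)⁻¹ := fun y => by
    rw [norm_inv, Complex.norm_real, Real.norm_of_nonneg (hHpos y).le]
  have hHne : ∀ y, (H y : ℂ) ≠ 0 := fun y => Complex.ofReal_ne_zero.2 (hHpos y).ne'
  let T : (ℝ →ᵇ ℂ) → (ℝ →ᵇ ℂ) := fun R => BoundedContinuousFunction.ofNormedAddCommGroup
    (fun y => (H y : ℂ)⁻¹ * (f y + K (Hb * R) y))
    (((Complex.continuous_ofReal.comp hHc).inv₀ hHne).mul (f.continuous.add (hKc _)))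
    (‖f‖ + ‖R‖ / 2) fun y => by
      rw [norm_mul, hinv, inv_mul_le_iff₀ (hHpos y)]
      have h1 := hKH R y
      have h2 := f.norm_coe_le_norm y
      have h3 := norm_add_le (f y) (K (Hb * R) y)
      nlinarith [hH1 y, norm_nonneg f]
  have hT : ContractingWith (1 / 2) T := by
    refine ⟨by norm_num, LipschitzWith.of_dist_le_mul fun R Q => ?_⟩
    rw [BoundedContinuousFunction.dist_le (by positivity)]
    intro y
    have h1 := hKH (R - Q) y
    rw [mul_sub, hKs] at h1
    change dist ((H y : ℂ)⁻¹ * (f y + K (Hb * R) y)) ((H y : ℂ)⁻¹ * (f y + K (Hb * Q) y)) ≤ _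
    rw [dist_eq_norm, ← mul_sub, add_sub_add_left_eq_sub, norm_mul, hinv,
      inv_mul_le_iff₀ (hHpos y), dist_eq_norm]
    refine h1.trans (le_of_eq ?_)
    push_cast
    ring
  have hfix := hT.fixedPoint_isFixedPt
  set R := ContractingWith.fixedPoint T hT
  refine ⟨Hb * R, fun y => ?_⟩
  have h1 : (H y : ℂ)⁻¹ * (f y + K (Hb * R) y) = R y :=
    congrArg (fun Q : ℝ →ᵇ ℂ => Q y) hfix
  have h2 : (Hb * R) y = f y + K (Hb * R) y := by
    rw [BoundedContinuousFunction.coe_mul, Pi.mul_apply, hHb, ← h1, mul_inv_cancel_left₀ (hHne y)]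
  rw [h2]
  simp only [K, expVolterra_zero]
  ring

end Volterra

section SecondOrder

variable {k : ℂ} {e : ℝ → ℂ} {s : Set ℝ}

/-- `U` solves `U'' = (k² + e) U` on `s`, with derivative `U'`. -/
def IsSol (k : ℂ) (e : ℝ → ℂ) (s : Set ℝ) (U U' : ℝ → ℂ) : Prop :=
  (∀ y ∈ s, HasDerivWithinAt U (U' y) s y) ∧
    ∀ y ∈ s, HasDerivWithinAt U' ((k ^ 2 + e y) * U y) s y

/-- The Wronskian of two solutions with derivatives `U'` and `V'`. -/
def wronsk (U U' V V' : ℝ → ℂ) (y : ℝ) : ℂ := U y * V' y - U' y * V y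

theorem IsSol.div_const {U U' : ℝ → ℂ} (h : IsSol k e s U U') (c : ℂ) :
    IsSol k e s (fun y => U y / c) fun y => U' y / c :=
  ⟨fun y hy => (h.1 y hy).div_const c, fun y hy => by
    simpa only [mul_div_assoc] using (h.2 y hy).div_const c⟩

theorem IsSol.of_system (hk : k ≠ 0) {p q : ℝ → ℂ}
    (hp : ∀ y ∈ s, HasDerivWithinAt p (2 * k * p y + e y / (2 * k) * (p y + q y)) s y)
    (hq : ∀ y ∈ s, HasDerivWithinAt q (-(e y / (2 * k) * (p y + q y))) s y) :
    IsSol k e s (fun y => Complex.exp (-k * y) * (p y + q y))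
      fun y => k * Complex.exp (-k * y) * (p y - q y) := by
  have hE : ∀ y : ℝ, HasDerivWithinAt (fun y : ℝ => Complex.exp (-k * y))
      (-k * Complex.exp (-k * y)) s y := fun y => by
    have h := ((Complex.ofRealCLM.hasDerivAt (x := y)).const_mul (-k)).cexp
    refine h.hasDerivWithinAt.congr_deriv ?_
    simp [mul_comm]
  refine ⟨fun y hy => ?_, fun y hy => ?_⟩
  · refine ((hE y).mul ((hp y hy).add (hq y hy))).congr_deriv ?_
    simp only [Pi.add_apply]
    ring
  · refine (((hE y).const_mul k).mul ((hp y hy).sub (hq y hy))).congr_deriv ?_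
    simp only [Pi.sub_apply]
    field_simp
    ring

theorem wronsk_eq {y₀ : ℝ} {U U' V V' : ℝ → ℂ} (hU : IsSol k e (Ici y₀) U U')
    (hV : IsSol k e (Ici y₀) V V') {y : ℝ} (hy : y₀ ≤ y) :
    wronsk U U' V V' y = wronsk U U' V V' y₀ := by
  have hd : ∀ x ∈ Ici y₀, HasDerivWithinAt (wronsk U U' V V') 0 (Ici y₀) x := fun x hx => by
    refine (((hU.1 x hx).mul (hV.2 x hx)).sub ((hU.2 x hx).mul (hV.1 x hx))).congr_deriv ?_
    ring
  refine constant_of_has_deriv_right_zero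
    (fun x hx => ((hd x hx.1).continuousWithinAt).mono Icc_subset_Ici_self)
    (fun x hx => (hd x hx.1).mono (Ici_subset_Ici.2 hx.1)) y ⟨hy, le_rfl⟩

theorem IsSol.eq_combination {y₀ : ℝ} {U U' V V' Z Z' : ℝ → ℂ} (hU : IsSol k e (Ici y₀) U U')
    (hV : IsSol k e (Ici y₀) V V') (hZ : IsSol k e (Ici y₀) Z Z')
    (h : wronsk U U' V V' y₀ ≠ 0) {y : ℝ} (hy : y₀ ≤ y) :
    Z y = wronsk Z Z' V V' y₀ / wronsk U U' V V' y₀ * U y +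
      wronsk U U' Z Z' y₀ / wronsk U U' V V' y₀ * V y := by
  field_simp
  rw [← wronsk_eq hU hV hy, ← wronsk_eq hU hZ hy, ← wronsk_eq hZ hV hy]
  simp only [wronsk]
  ring

theorem IsSol.neg {U U' : ℝ → ℂ} (h : IsSol k (fun y => e (-y)) univ U U') :
    IsSol k e univ (fun y => U (-y)) fun y => -U' (-y) := by
  have hn : ∀ y : ℝ, HasDerivAt (fun y : ℝ => -y) (-1) y := fun y => (hasDerivAt_id y).neg
  refine ⟨fun y _ => ?_, fun y _ => ?_⟩
  · have h1 := ((h.1 (-y) trivial).hasDerivAt univ_mem).scomp y (hn y)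
    exact h1.hasDerivWithinAt.congr_deriv (by simp)
  · have h1 := (((h.2 (-y) trivial).hasDerivAt univ_mem).scomp y (hn y)).neg
    exact h1.hasDerivWithinAt.congr_deriv (by simp)

theorem hasDerivAt_exp_mul {F : ℝ → ℂ} {κ c : ℂ} {y : ℝ}
    (hF : HasDerivAt F (Complex.exp (-κ * y) * c) y) :
    HasDerivAt (fun y : ℝ => Complex.exp (κ * y) * F y) (κ * (Complex.exp (κ * y) * F y) + c) y := by
  have hE := ((Complex.ofRealCLM.hasDerivAt (x := y)).const_mul κ).cexp
  refine (hE.mul hF).congr_deriv ?_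
  simp only [Complex.ofRealCLM_apply, Complex.ofReal_one, mul_one, neg_mul, Complex.exp_neg]
  field_simp [Complex.exp_ne_zero]

theorem exists_isSol_tendsto_atBot (hk : k.re < 0) (he : Continuous e) (hei : Integrable e) :
    ∃ V V' : ℝ → ℂ, IsSol k e univ V V' ∧
      Tendsto (fun y : ℝ => V y * Complex.exp (k * y)) atBot (𝓝 1) ∧
      Tendsto (fun y : ℝ => V' y * Complex.exp (k * y)) atBot (𝓝 (-k)) := by
  have hk0 : k ≠ 0 := by rintro rfl; simp at hk
  have hκ : (2 * k).re ≤ 0 := by simp; linarith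
  set g : ℝ → ℂ := fun y => e y / (2 * k) with hg
  have hgc : Continuous g := he.div_const _
  have hgi : Integrable g := hei.div_const _
  obtain ⟨S, hS⟩ := exists_volterra_solution hκ hgc.aestronglyMeasurable hgc.norm hgi.norm
    (fun s => le_rfl) (BoundedContinuousFunction.const ℝ (1 : ℂ))
  set φ : ℝ → ℂ := fun s => g s * S s with hφ
  have hφc : Continuous φ := hgc.mul S.continuous
  have hφi : Integrable φ := hgi.mul_bdd (c := ‖S‖) S.continuous.aestronglyMeasurable
      (Eventually.of_forall S.norm_coe_le_norm)
  have hS' : ∀ y, S y = expVolterra (2 * k) φ y + (1 - ∫ s in Iic y, φ s) := fun y => by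
    rw [hS y, BoundedContinuousFunction.const_apply]; ring
  have hp0 := tendsto_expVolterra_atBot hκ hφi
  have hq0 : Tendsto (fun y => 1 - ∫ s in Iic y, φ s) atBot (𝓝 1) := by
    simpa using (tendsto_integral_Iic_zero (f := φ) (μ := volume) tendsto_id).const_sub 1
  have hexp : ∀ y : ℝ, Complex.exp (-k * y) * Complex.exp (k * y) = 1 := fun y => by
    rw [← Complex.exp_add]; simp
  refine ⟨_, _, IsSol.of_system (p := expVolterra (2 * k) φ)
    (q := fun y => 1 - ∫ s in Iic y, φ s) hk0 (fun y _ => ?_) (fun y _ => ?_), ?_, ?_⟩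
  · rw [← hS']
    refine (hasDerivAt_exp_mul ?_).hasDerivWithinAt
    exact hasDerivAt_integral_Iic (F := fun s : ℝ => Complex.exp (-(2 * k) * s) * φ s)
      (integrableOn_exp_neg_mul hκ hφi) (by fun_prop) y
  · rw [← hS']
    exact ((hasDerivAt_integral_Iic (fun y => hφi.integrableOn) hφc y).const_sub
      1).hasDerivWithinAt
  · have := hp0.add hq0
    rw [zero_add] at this
    refine this.congr fun y => ?_
    linear_combination -(expVolterra (2 * k) φ y + (1 - ∫ s in Iic y, φ s)) * hexp y
  · have := (hp0.sub hq0).const_mul k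
    rw [zero_sub, mul_neg_one] at this
    refine this.congr fun y => ?_
    linear_combination -k * (expVolterra (2 * k) φ y - (1 - ∫ s in Iic y, φ s)) * hexp y

theorem exists_isSol_tendsto_atTop (hk : k.re < 0) (he : Continuous e) (hei : Integrable e) :
    ∃ W W' : ℝ → ℂ, IsSol k e univ W W' ∧
      Tendsto (fun y : ℝ => W y * Complex.exp (-k * y)) atTop (𝓝 1) ∧
      Tendsto (fun y : ℝ => W' y * Complex.exp (-k * y)) atTop (𝓝 k) := by
  obtain ⟨V, V', hV, h1, h2⟩ := exists_isSol_tendsto_atBot (e := fun y => e (-y)) hk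
    (he.comp continuous_neg) hei.comp_neg
  refine ⟨_, _, hV.neg, ?_, ?_⟩
  · refine (h1.comp tendsto_neg_atTop_atBot).congr fun y => ?_
    simp
  · have := (h2.comp tendsto_neg_atTop_atBot).neg
    rw [neg_neg] at this
    refine this.congr fun y => ?_
    simp

theorem exists_isSol_forward (hk : k.re < 0) (he : Continuous e) (hei : Integrable e) (y₀ : ℝ)
    (a b : ℂ) :
    ∃ (U U' : ℝ → ℂ) (L : ℂ), IsSol k e (Ici y₀) U U' ∧
      U y₀ = Complex.exp (-k * y₀) * (a + b) ∧ U' y₀ = k * Complex.exp (-k * y₀) * (a - b) ∧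
      Tendsto (fun y : ℝ => U y * Complex.exp (k * y)) atTop (𝓝 L) ∧
      Tendsto (fun y : ℝ => U' y * Complex.exp (k * y)) atTop (𝓝 (-k * L)) := by
  have hk0 : k ≠ 0 := by rintro rfl; simp at hk
  have hκ : (2 * k).re < 0 := by simp; linarith
  set G : ℝ → ℂ := fun y => e y / (2 * k) with hG
  have hGc : Continuous G := he.div_const _
  have hGi : Integrable G := hei.div_const _
  set g : ℝ → ℂ := (Ici y₀).indicator G with hg
  have hgi : Integrable g := hGi.indicator measurableSet_Ici
  set a' : ℂ := Complex.exp (-(2 * k) * y₀) * a with ha'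
  have ha'' : Complex.exp (2 * k * y₀) * a' = a := by
    rw [ha', ← mul_assoc, ← Complex.exp_add]; simp
  let f : ℝ →ᵇ ℂ := BoundedContinuousFunction.ofNormedAddCommGroup
    (fun y => Complex.exp (2 * k * (max y y₀ : ℝ)) * a' + b) (by fun_prop) (‖a‖ + ‖b‖) fun y => by
      refine (norm_add_le _ _).trans (add_le_add_left ?_ _)
      rw [ha', ← mul_assoc, norm_mul]
      exact mul_le_of_le_one_left (norm_nonneg _)
        (norm_exp_mul_exp_neg_le hκ.le (le_max_right _ _))
  obtain ⟨S, hS⟩ := exists_volterra_solution hκ.le hgi.aestronglyMeasurable hGc.norm hGi.norm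
    (fun s => norm_indicator_le_norm_self _ _) f
  set φ : ℝ → ℂ := fun s => g s * S s with hφ
  have hφi : Integrable φ := hgi.mul_bdd (c := ‖S‖) S.continuous.aestronglyMeasurable
      (Eventually.of_forall S.norm_coe_le_norm)
  set Φ : ℝ → ℂ := fun s => G s * S s with hΦ
  have hΦc : Continuous Φ := hGc.mul S.continuous
  have hmul : ∀ (w : ℝ → ℂ) {y : ℝ}, y₀ ≤ y →
      ∫ s in Iic y, w s * φ s = ∫ s in y₀..y, w s * Φ s := fun w y hy => by
    have h1 : (fun s => w s * φ s) = (Ici y₀).indicator fun s => w s * Φ s := by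
      ext s
      by_cases hs : s ∈ Ici y₀ <;> simp [hφ, hΦ, hg, hs]
    rw [h1, setIntegral_indicator measurableSet_Ici, intervalIntegral.integral_of_le hy,
      inter_comm, Ici_inter_Iic, integral_Icc_eq_integral_Ioc]
  set p : ℝ → ℂ := fun y => Complex.exp (2 * k * y) *
    (a' + ∫ s in y₀..y, Complex.exp (-(2 * k) * s) * Φ s) with hp
  set q : ℝ → ℂ := fun y => b - ∫ s in y₀..y, Φ s with hq
  have hp' : ∀ {y}, y₀ ≤ y → p y = Complex.exp (2 * k * y) * a' + expVolterra (2 * k) φ y :=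
    fun {y} hy => by
      simp only [hp]
      rw [expVolterra, hmul _ hy]; ring
  have hq' : ∀ {y}, y₀ ≤ y → q y = b - ∫ s in Iic y, φ s := fun {y} hy => by
    have := hmul (fun _ => 1) hy
    simp only [one_mul] at this
    rw [this]
  have hSpq : ∀ {y}, y₀ ≤ y → S y = p y + q y := fun {y} hy => by
    rw [hS y, hp' hy, hq' hy]
    change Complex.exp (2 * k * (max y y₀ : ℝ)) * a' + b + _ - _ = _
    rw [max_eq_left hy]
    ring
  have hplim : Tendsto p atTop (𝓝 0) := by
    have h := ((tendsto_exp_mul_atTop hκ).mul_const a').add (tendsto_expVolterra_atTop hκ hφi)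
    rw [zero_mul, zero_add] at h
    refine h.congr' ?_
    filter_upwards [eventually_ge_atTop y₀] with y hy using (hp' hy).symm
  have hqlim : Tendsto q atTop (𝓝 (b - ∫ s, φ s)) := by
    have h := ((aecover_Iic (μ := volume)
      (tendsto_id (α := ℝ) (x := atTop))).integral_tendsto_of_countably_generated hφi).const_sub b
    refine h.congr' ?_
    filter_upwards [eventually_ge_atTop y₀] with y hy using (hq' hy).symm
  have hexp : ∀ y : ℝ, Complex.exp (-k * y) * Complex.exp (k * y) = 1 := fun y => by
    rw [← Complex.exp_add]; simp
  refine ⟨_, _, b - ∫ s, φ s, IsSol.of_system (p := p) (q := q) hk0 (fun y hy => ?_)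
    (fun y hy => ?_), ?_, ?_, ?_, ?_⟩
  · rw [← hSpq hy]
    refine (hasDerivAt_exp_mul ?_).hasDerivWithinAt
    exact (Continuous.integral_hasStrictDerivAt
      (by fun_prop : Continuous fun s : ℝ => Complex.exp (-(2 * k) * s) * Φ s)
      y₀ y).hasDerivAt.const_add _
  · rw [← hSpq hy]
    exact ((hΦc.integral_hasStrictDerivAt y₀ y).hasDerivAt.const_sub b).hasDerivWithinAt
  · simp [hp, hq, ha'']
  · simp [hp, hq, ha'']
  · have := hplim.add hqlim
    rw [zero_add] at this
    refine this.congr fun y => ?_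
    linear_combination -(p y + q y) * hexp y
  · have := (hplim.sub hqlim).const_mul k
    rw [zero_sub, mul_neg, ← neg_mul] at this
    refine this.congr fun y => ?_
    linear_combination -k * (p y - q y) * hexp y

theorem exists_jost_basis (hk : k.re < 0) (he : Continuous e) (hei : Integrable e) (y₀ : ℝ) :
    ∃ Wp Wp' Wm Wm' : ℝ → ℂ, IsSol k e (Ici y₀) Wp Wp' ∧ IsSol k e (Ici y₀) Wm Wm' ∧
      Tendsto (fun y : ℝ => Wp y * Complex.exp (-k * y)) atTop (𝓝 1) ∧
      Tendsto (fun y : ℝ => Wp' y * Complex.exp (-k * y)) atTop (𝓝 k) ∧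
      Tendsto (fun y : ℝ => Wm y * Complex.exp (k * y)) atTop (𝓝 1) ∧
      Tendsto (fun y : ℝ => Wm' y * Complex.exp (k * y)) atTop (𝓝 (-k)) ∧
      wronsk Wp Wp' Wm Wm' y₀ ≠ 0 := by
  have hk0 : k ≠ 0 := by rintro rfl; simp at hk
  have hE0 := Complex.exp_ne_zero (-k * y₀)
  obtain ⟨W, W', hW, hW1, hW2⟩ := exists_isSol_tendsto_atTop hk he hei
  replace hW : IsSol k e (Ici y₀) W W' := ⟨fun y _ => (hW.1 y trivial).mono (subset_univ _),
    fun y _ => (hW.2 y trivial).mono (subset_univ _)⟩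
  obtain ⟨U, U', L, hU, hUW, hU1, hU2⟩ : ∃ (U U' : ℝ → ℂ) (L : ℂ), IsSol k e (Ici y₀) U U' ∧
      wronsk W W' U U' y₀ ≠ 0 ∧
      Tendsto (fun y : ℝ => U y * Complex.exp (k * y)) atTop (𝓝 L) ∧
      Tendsto (fun y : ℝ => U' y * Complex.exp (k * y)) atTop (𝓝 (-k * L)) := by
    obtain ⟨U, U', L, hU, h0, h0', h1, h2⟩ := exists_isSol_forward hk he hei y₀ 1 0
    obtain ⟨V, V', M, hV, g0, g0', g1, g2⟩ := exists_isSol_forward hk he hei y₀ 0 1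
    by_contra! hcon
    have hWU : wronsk W W' U U' y₀ = 0 := by
      by_contra h
      exact hcon U U' L hU h h1 h2
    have hWV : wronsk W W' V V' y₀ = 0 := by
      by_contra h
      exact hcon V V' M hV h g1 g2
    have hUV : wronsk U U' V V' y₀ ≠ 0 := by
      have : wronsk U U' V V' y₀ = -2 * k * Complex.exp (-k * y₀) ^ 2 := by
        simp only [wronsk, h0, h0', g0, g0']; ring
      rw [this]
      exact mul_ne_zero (mul_ne_zero (by norm_num) hk0) (pow_ne_zero _ hE0)
    have hUW : wronsk U U' W W' y₀ = 0 := by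
      rw [← neg_eq_zero, ← hWU]; simp only [wronsk]; ring
    have hz : (fun y : ℝ => W y * Complex.exp (-k * y)) =ᶠ[atTop] fun _ => 0 := by
      filter_upwards [eventually_ge_atTop y₀] with y hy
      rw [hU.eq_combination hV hW hUV hy, hWV, hUW]
      simp
    exact zero_ne_one (tendsto_nhds_unique tendsto_const_nhds (hW1.congr' hz))
  have hexp : ∀ y : ℝ, Complex.exp (-k * y) * Complex.exp (k * y) = 1 := fun y => by
    rw [← Complex.exp_add]; simp
  have hL : L ≠ 0 := by
    rintro rfl
    have h := (hW1.mul hU2).sub (hW2.mul hU1)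
    simp only [mul_zero, sub_zero] at h
    have hc : (fun y : ℝ => W y * Complex.exp (-k * y) * (U' y * Complex.exp (k * y)) -
        W' y * Complex.exp (-k * y) * (U y * Complex.exp (k * y))) =ᶠ[atTop]
        fun _ => wronsk W W' U U' y₀ := by
      filter_upwards [eventually_ge_atTop y₀] with y hy
      rw [← wronsk_eq hW hU hy, wronsk]
      linear_combination (W y * U' y - W' y * U y) * hexp y
    exact hUW (tendsto_nhds_unique tendsto_const_nhds (h.congr' hc))
  refine ⟨W, W', _, _, hW, hU.div_const L, hW1, hW2, ?_, ?_, ?_⟩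
  · simpa [div_mul_eq_mul_div, hL] using hU1.div_const L
  · have h := hU2.div_const L
    rw [mul_div_cancel_right₀ _ hL] at h
    simpa only [div_mul_eq_mul_div] using h
  · have : wronsk W W' (fun y => U y / L) (fun y => U' y / L) y₀ = wronsk W W' U U' y₀ / L := by
      simp only [wronsk]; ring
    rw [this]
    exact div_ne_zero hUW hL

theorem exists_continuous_integrable_extension {y₀ : ℝ} (hc : ContinuousOn e (Ici y₀))
    (hi : IntegrableOn (fun y => ‖e y‖) (Ici y₀)) :
    ∃ E : ℝ → ℂ, Continuous E ∧ Integrable E ∧ EqOn E e (Ici y₀) := by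
  have hEq : EqOn (fun y => Real.exp (min (y - y₀) 0) * e (max y y₀)) e (Ici y₀) := fun y hy => by
    have hy' : y₀ ≤ y := hy
    simp [hy']
  have hC : Continuous fun y => Real.exp (min (y - y₀) 0) * e (max y y₀) := by
    have h1 : Continuous fun y => e (max y y₀) :=
      hc.comp_continuous (by fun_prop) fun y => mem_Ici.2 (le_max_right _ _)
    have h2 : Continuous fun y => (Real.exp (min (y - y₀) 0) : ℂ) := by fun_prop
    exact h2.mul h1
  refine ⟨_, hC, ?_, hEq⟩
  rw [← integrableOn_univ, ← Iic_union_Ici (a := y₀), integrableOn_union]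
  constructor
  · have h := ((integrableOn_exp_Iic y₀).mul_const (Real.exp (-y₀) * ‖e y₀‖))
    refine h.mono' hC.aestronglyMeasurable.restrict ?_
    filter_upwards [ae_restrict_mem measurableSet_Iic] with y hy
    have hy' : y ≤ y₀ := hy
    rw [max_eq_right hy', min_eq_left (by linarith), norm_mul, Complex.norm_real, Real.norm_eq_abs,
      Real.abs_exp, sub_eq_add_neg, Real.exp_add, mul_assoc]
  · have h : IntegrableOn e (Ici y₀) :=
      (integrable_norm_iff (hc.aestronglyMeasurable measurableSet_Ici)).1 hi
    exact h.congr_fun hEq.symm measurableSet_Ici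

end SecondOrder

/-- Jost-type solutions with prescribed asymptotics at `+∞`. -/
theorem stmt15 (σ y₀ : ℝ) (hσ : σ < 0) (ε : ℝ → ℂ)
    (hcont : ContinuousOn ε (Ici y₀))
    (hint : IntegrableOn (fun y => ‖ε y‖) (Ici y₀)) :
    ∃ Wp Wp' Wm Wm' : ℝ → ℂ,
      (∀ y ∈ Ici y₀, HasDerivWithinAt Wp (Wp' y) (Ici y₀) y) ∧
      (∀ y ∈ Ici y₀,
        HasDerivWithinAt Wp' ((((σ : ℂ) - Complex.I) ^ 2 + ε y) * Wp y) (Ici y₀) y) ∧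
      (∀ y ∈ Ici y₀, HasDerivWithinAt Wm (Wm' y) (Ici y₀) y) ∧
      (∀ y ∈ Ici y₀,
        HasDerivWithinAt Wm' ((((σ : ℂ) - Complex.I) ^ 2 + ε y) * Wm y) (Ici y₀) y) ∧
      Tendsto (fun y : ℝ => Wp y * Complex.exp ((Complex.I - (σ : ℂ)) * (y : ℂ)))
        atTop (𝓝 1) ∧
      Tendsto (fun y : ℝ => Wp' y * Complex.exp ((Complex.I - (σ : ℂ)) * (y : ℂ)))
        atTop (𝓝 ((σ : ℂ) - Complex.I)) ∧
      Tendsto (fun y : ℝ => Wm y * Complex.exp (((σ : ℂ) - Complex.I) * (y : ℂ)))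
        atTop (𝓝 1) ∧
      Tendsto (fun y : ℝ => Wm' y * Complex.exp (((σ : ℂ) - Complex.I) * (y : ℂ)))
        atTop (𝓝 (-(σ : ℂ) + Complex.I)) ∧
      ∀ U U' : ℝ → ℂ,
        (∀ y ∈ Ici y₀, HasDerivWithinAt U (U' y) (Ici y₀) y) →
        (∀ y ∈ Ici y₀,
          HasDerivWithinAt U' ((((σ : ℂ) - Complex.I) ^ 2 + ε y) * U y) (Ici y₀) y) →
        ∃ A B : ℂ, ∀ y ∈ Ici y₀, U y = A * Wp y + B * Wm y := by
  obtain ⟨E, hEc, hEi, hE⟩ := exists_continuous_integrable_extension hcont hint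
  have hk : ((σ : ℂ) - Complex.I).re < 0 := by simpa using hσ
  obtain ⟨Wp, Wp', Wm, Wm', hp, hm, hp1, hp2, hm1, hm2, hw⟩ := exists_jost_basis hk hEc hEi y₀
  refine ⟨Wp, Wp', Wm, Wm', hp.1, fun y hy => hE hy ▸ hp.2 y hy, hm.1,
    fun y hy => hE hy ▸ hm.2 y hy, by simpa using hp1, by simpa using hp2, hm1,
    by simpa [sub_eq_add_neg, add_comm] using hm2, fun U U' hU hU' => ?_⟩
  have hsol : IsSol ((σ : ℂ) - Complex.I) E (Ici y₀) U U' :=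
    ⟨hU, fun y hy => (hE hy).symm ▸ hU' y hy⟩
  exact ⟨_, _, fun y hy => hp.eq_combination hm hsol hw hy⟩
end
end

section
/- For every real δ with 0 < δ < 1, the improper integral ∫_0^∞ t^(δ−1) e^(−it) dt converges (as the limit of ∫_0^T t^(δ−1) e^(−it) dt as T → ∞) and equals i^(−δ) Γ(δ) = e^(−iπδ/2) Γ(δ), where Γ is the Gamma function. -/
open MeasureTheory Set Filter Topology

noncomputable section

/-- The Laplace transform of `t ↦ t ^ (a - 1)` converges absolutely on the right half-plane. -/
theorem integrableOn_rpow_mul_cexp_neg_mul_Ioi {a : ℝ} (ha : 0 < a) {r : ℂ} (hr : 0 < r.re) :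
    IntegrableOn (fun t : ℝ => ((t ^ (a - 1) : ℝ) : ℂ) * Complex.exp (-(r * t))) (Ioi 0) := by
  have h := integrableOn_rpow_mul_exp_neg_mul_rpow (p := 1) (s := a - 1) (by linarith)
    one_pos hr
  refine h.mono' (by fun_prop) ?_
  filter_upwards [ae_restrict_mem measurableSet_Ioi] with t ht
  have ht' : (0 : ℝ) ≤ t ^ (a - 1) := Real.rpow_nonneg (le_of_lt ht) _
  simp [Complex.norm_exp, abs_of_nonneg ht']

/-- The Laplace transform of `t ↦ t ^ (a - 1)` on the right half-plane. -/
theorem integral_rpow_mul_cexp_neg_mul_Ioi {a : ℝ} (ha : 0 < a) {r : ℂ} (hr : 0 < r.re) :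
    ∫ t in Ioi (0 : ℝ), ((t ^ (a - 1) : ℝ) : ℂ) * Complex.exp (-(r * t)) =
      r ^ (-(a : ℂ)) * (Real.Gamma a : ℂ) := by
  let w : ℝ → NNReal := fun t => (t ^ (a - 1)).toNNReal
  have hw : Measurable w := by fun_prop
  let μ : Measure ℝ := (volume.restrict (Ioi 0)).withDensity (fun t => w t)
  have hμ (z : ℂ) : ProbabilityTheory.complexMGF id μ z =
      ∫ t in Ioi (0 : ℝ), ((t ^ (a - 1) : ℝ) : ℂ) * Complex.exp (z * t) := by
    rw [ProbabilityTheory.complexMGF, integral_withDensity_eq_integral_smul hw]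
    refine setIntegral_congr_fun measurableSet_Ioi fun t ht => ?_
    have ht' : (0 : ℝ) ≤ t ^ (a - 1) := Real.rpow_nonneg (le_of_lt ht) _
    simp [w, NNReal.smul_def, ht']
  have hsub : Iio 0 ⊆ ProbabilityTheory.integrableExpSet id μ := by
    intro s hs
    change Integrable _ _
    rw [integrable_withDensity_iff_integrable_smul hw]
    have h := integrableOn_rpow_mul_exp_neg_mul_rpow (p := 1) (s := a - 1) (b := -s)
      (by linarith) one_pos (neg_pos.mpr hs)
    refine h.congr_fun (fun t ht => ?_) measurableSet_Ioi
    have ht' : (0 : ℝ) ≤ t ^ (a - 1) := Real.rpow_nonneg (le_of_lt ht) _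
    simp [w, NNReal.smul_def, ht']
  have hopen : IsOpen {z : ℂ | z.re < 0} := isOpen_lt Complex.continuous_re continuous_const
  have hF : AnalyticOnNhd ℂ (ProbabilityTheory.complexMGF id μ) {z : ℂ | z.re < 0} :=
    ProbabilityTheory.analyticOnNhd_complexMGF.mono fun z hz =>
      interior_maximal hsub isOpen_Iio hz
  have hG : AnalyticOnNhd ℂ (fun z : ℂ => (-z) ^ (-(a : ℂ)) * (Real.Gamma a : ℂ))
      {z : ℂ | z.re < 0} := by
    refine DifferentiableOn.analyticOnNhd (fun z hz => ?_) hopen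
    have hz' : -z ∈ Complex.slitPlane := Or.inl (by simpa using hz)
    exact ((differentiableAt_id.neg.cpow_const hz').mul_const _).differentiableWithinAt
  have hreal (s : ℝ) (hs : s < 0) : ProbabilityTheory.complexMGF id μ s =
      (-(s : ℂ)) ^ (-(a : ℂ)) * (Real.Gamma a : ℂ) := by
    rw [hμ, ← Complex.Gamma_ofReal]
    have h := Complex.integral_cpow_mul_exp_neg_mul_Ioi (a := a) (r := -s) (by simpa using ha)
      (neg_pos.mpr hs)
    have harg : Complex.arg (-(s : ℂ)) ≠ Real.pi := by
      rw [← Complex.ofReal_neg, Complex.arg_ofReal_of_nonneg (by linarith)]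
      exact Real.pi_ne_zero.symm
    rw [Complex.ofReal_neg, one_div, Complex.inv_cpow _ _ harg, ← Complex.cpow_neg] at h
    rw [← h]
    refine setIntegral_congr_fun measurableSet_Ioi fun t ht => ?_
    simp [Complex.ofReal_cpow (le_of_lt ht)]
  have htend : Tendsto (fun s : ℝ => (s : ℂ)) (𝓝[≠] (-1)) (𝓝[≠] ((-1 : ℝ) : ℂ)) :=
    Complex.continuous_ofReal.continuousWithinAt.tendsto_nhdsWithin fun s hs => by
      simpa [Complex.ofReal_inj] using fun h => hs (Complex.ofReal_injective (by simpa using h))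
  have hfreq : ∃ᶠ z in 𝓝[≠] ((-1 : ℝ) : ℂ), ProbabilityTheory.complexMGF id μ z =
      (-z) ^ (-(a : ℂ)) * (Real.Gamma a : ℂ) := by
    refine htend.frequently (Eventually.frequently ?_)
    filter_upwards [nhdsWithin_le_nhds (Iio_mem_nhds (show (-1 : ℝ) < 0 by norm_num))] with s hs
    exact hreal s hs
  have hmem : -r ∈ {z : ℂ | z.re < 0} := by simpa using hr
  have h := hF.eqOn_of_preconnected_of_frequently_eq hG
    (convex_halfSpace_re_lt 0).isPreconnected (by simp) hfreq hmem
  simpa [hμ] using h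

/-- Integration by parts bounds a piece of the Laplace transform of `t ↦ t ^ (a - 1)` away from
the origin, uniformly up to the boundary of the right half-plane. -/
theorem norm_integral_rpow_mul_cexp_neg_mul_le {a : ℝ} (ha : a < 1) {r : ℂ} (hr : 0 ≤ r.re)
    (hr0 : r ≠ 0) {T S : ℝ} (hT : 0 < T) (hTS : T ≤ S) :
    ‖∫ t in T..S, ((t ^ (a - 1) : ℝ) : ℂ) * Complex.exp (-(r * t))‖ ≤
      2 * T ^ (a - 1) / ‖r‖ := by
  have hpos : ∀ t ∈ uIcc T S, 0 < t := fun t ht => by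
    rw [uIcc_of_le hTS] at ht
    exact hT.trans_le ht.1
  have hu : ∀ t ∈ uIcc T S, HasDerivAt (fun t : ℝ => t ^ (a - 1)) ((a - 1) * t ^ (a - 1 - 1)) t :=
    fun t ht => Real.hasDerivAt_rpow_const (Or.inl (hpos t ht).ne')
  have hv : ∀ t ∈ uIcc T S, HasDerivAt (fun t : ℝ => -Complex.exp (-(r * t)) / r)
      (Complex.exp (-(r * t))) t := fun t _ => by
    have h : HasDerivAt (fun z : ℂ => -Complex.exp (-(r * z)) / r)
        (-(Complex.exp (-(r * t)) * -(r * 1)) / r) (t : ℂ) :=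
      (((hasDerivAt_id (t : ℂ)).const_mul r).neg.cexp.neg).div_const r
    convert h.comp_ofReal using 1
    field_simp
  have hu' : IntervalIntegrable (fun t : ℝ => (a - 1) * t ^ (a - 1 - 1)) volume T S :=
    (intervalIntegral.intervalIntegrable_rpow
      (Or.inr fun h => (hpos 0 h).false)).const_mul _
  have hnorm (t : ℝ) (ht : 0 ≤ t) : ‖-Complex.exp (-(r * t)) / r‖ ≤ 1 / ‖r‖ := by
    rw [norm_div, norm_neg, Complex.norm_exp]
    gcongr
    simpa using mul_nonneg hr ht
  have hS : 0 < S := hT.trans_le hTS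
  have hparts := intervalIntegral.integral_mul_deriv_eq_deriv_mul
    (fun t ht => (hu t ht).ofReal_comp) hv ⟨hu'.1.ofReal, hu'.2.ofReal⟩
    (Continuous.intervalIntegrable (by fun_prop) _ _)
  have hbound : ‖∫ t in T..S, (((a - 1) * t ^ (a - 1 - 1) : ℝ) : ℂ) *
      (-Complex.exp (-(r * t)) / r)‖ ≤ (T ^ (a - 1) - S ^ (a - 1)) / ‖r‖ := by
    calc _ ≤ ∫ t in T..S, -((a - 1) * t ^ (a - 1 - 1)) * (1 / ‖r‖) := by
          refine intervalIntegral.norm_integral_le_of_norm_le hTS (ae_of_all _ fun t ht => ?_)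
            (hu'.neg.mul_const _)
          have ht0 : 0 < t := hT.trans ht.1
          have hle : (a - 1) * t ^ (a - 1 - 1) ≤ 0 :=
            mul_nonpos_of_nonpos_of_nonneg (by linarith) (Real.rpow_nonneg ht0.le _)
          rw [norm_mul, Complex.norm_real, Real.norm_eq_abs, abs_of_nonpos hle]
          exact mul_le_mul_of_nonneg_left (hnorm t ht0.le) (by linarith)
      _ = _ := by
          rw [intervalIntegral.integral_mul_const, intervalIntegral.integral_neg,
            intervalIntegral.integral_eq_sub_of_hasDerivAt hu hu']
          ring
  rw [hparts]
  have hend (x : ℝ) (hx : 0 < x) : ‖((x ^ (a - 1) : ℝ) : ℂ) * (-Complex.exp (-(r * x)) / r)‖ ≤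
      x ^ (a - 1) / ‖r‖ := by
    have hx' : (0 : ℝ) ≤ x ^ (a - 1) := Real.rpow_nonneg hx.le _
    rw [norm_mul, Complex.norm_real, Real.norm_eq_abs, abs_of_nonneg hx', div_eq_mul_one_div (x ^ (a - 1))]
    exact mul_le_mul_of_nonneg_left (hnorm x hx.le) hx'
  calc _ ≤ S ^ (a - 1) / ‖r‖ + T ^ (a - 1) / ‖r‖ + (T ^ (a - 1) - S ^ (a - 1)) / ‖r‖ :=
        norm_sub_le_of_le (norm_sub_le_of_le (hend S hS) (hend T hT)) hbound
    _ = _ := by ring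

/-- Truncation error of the Laplace transform of `t ↦ t ^ (a - 1)`. -/
theorem norm_Gamma_sub_integral_rpow_mul_cexp_le {a : ℝ} (ha0 : 0 < a) (ha1 : a < 1) {r : ℂ}
    (hr : 0 < r.re) {T : ℝ} (hT : 0 < T) :
    ‖r ^ (-(a : ℂ)) * (Real.Gamma a : ℂ) -
      ∫ t in (0 : ℝ)..T, ((t ^ (a - 1) : ℝ) : ℂ) * Complex.exp (-(r * t))‖ ≤
      2 * T ^ (a - 1) / ‖r‖ := by
  have hconv := integrableOn_rpow_mul_cexp_neg_mul_Ioi ha0 hr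
  have hlim := (intervalIntegral_tendsto_integral_Ioi 0 hconv tendsto_id).sub_const
    (∫ t in (0 : ℝ)..T, ((t ^ (a - 1) : ℝ) : ℂ) * Complex.exp (-(r * t)))
  rw [integral_rpow_mul_cexp_neg_mul_Ioi ha0 hr] at hlim
  refine le_of_tendsto hlim.norm ?_
  filter_upwards [eventually_ge_atTop T] with S hTS
  have hii (x : ℝ) (hx : 0 ≤ x) : IntervalIntegrable
      (fun t : ℝ => ((t ^ (a - 1) : ℝ) : ℂ) * Complex.exp (-(r * t))) volume 0 x :=
    (intervalIntegrable_iff_integrableOn_Ioc_of_le hx).mpr (hconv.mono_set Ioc_subset_Ioi_self)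
  rw [id, intervalIntegral.integral_interval_sub_left (hii S (hT.le.trans hTS)) (hii T hT.le)]
  exact norm_integral_rpow_mul_cexp_neg_mul_le ha1 hr.le (by rintro rfl; simp at hr) hT hTS

/-- The truncated Laplace transform of `t ↦ t ^ (a - 1)` is continuous on the closed right
half-plane. -/
theorem continuousWithinAt_integral_rpow_mul_cexp {a : ℝ} (ha : 0 < a) (r : ℂ) {T : ℝ}
    (hT : 0 ≤ T) :
    ContinuousWithinAt
      (fun z : ℂ => ∫ t in (0 : ℝ)..T, ((t ^ (a - 1) : ℝ) : ℂ) * Complex.exp (-(z * t)))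
      {z : ℂ | 0 ≤ z.re} r := by
  refine intervalIntegral.tendsto_integral_filter_of_dominated_convergence
    (fun t => t ^ (a - 1)) (Eventually.of_forall fun z => by fun_prop) ?_
    (intervalIntegral.intervalIntegrable_rpow' (by linarith)) ?_
  · filter_upwards [self_mem_nhdsWithin] with z hz
    refine ae_of_all _ fun t ht => ?_
    rw [uIoc_of_le hT] at ht
    have ht' : (0 : ℝ) ≤ t ^ (a - 1) := Real.rpow_nonneg ht.1.le _
    rw [norm_mul, Complex.norm_real, Real.norm_eq_abs, abs_of_nonneg ht', Complex.norm_exp]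
    refine mul_le_of_le_one_right ht' (Real.exp_le_one_iff.mpr ?_)
    simpa using mul_nonneg hz ht.1.le
  · refine ae_of_all _ fun t _ => ?_
    exact (Continuous.tendsto (by fun_prop) r).mono_left nhdsWithin_le_nhds

/-- the semi-convergent integral representation of `Γ(δ)`. -/
theorem stmt18 (δ : ℝ) (h0 : 0 < δ) (h1 : δ < 1) :
    Tendsto
      (fun T : ℝ => ∫ t in (0:ℝ)..T, ((t ^ (δ - 1) : ℝ) : ℂ) *
        Complex.exp (-Complex.I * (t : ℂ)))
      atTop (𝓝 (Complex.I ^ (-(δ : ℂ)) * (Real.Gamma δ : ℂ))) ∧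
    Complex.I ^ (-(δ : ℂ)) * (Real.Gamma δ : ℂ) =
      Complex.exp (-(Real.pi * δ / 2 : ℂ) * Complex.I) * (Real.Gamma δ : ℂ) := by
  refine ⟨?_, ?_⟩
  · have hbound (T : ℝ) (hT : 0 < T) : ‖(∫ t in (0 : ℝ)..T, ((t ^ (δ - 1) : ℝ) : ℂ) *
        Complex.exp (-Complex.I * (t : ℂ))) - Complex.I ^ (-(δ : ℂ)) * (Real.Gamma δ : ℂ)‖ ≤
        2 * T ^ (δ - 1) := by
      have hpath : Tendsto (fun ε : ℝ => (ε : ℂ) + Complex.I) (𝓝[>] 0) (𝓝 Complex.I) := by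
        have hc : Continuous fun ε : ℝ => (ε : ℂ) + Complex.I := by fun_prop
        simpa using (hc.tendsto 0).mono_left nhdsWithin_le_nhds
      have hre : ∀ᶠ ε : ℝ in 𝓝[>] 0, 0 < ((ε : ℂ) + Complex.I).re := by
        filter_upwards [self_mem_nhdsWithin] with ε hε
        simpa using hε
      have hpow := ((continuousAt_cpow_const (b := -(δ : ℂ)) (Or.inr (by simp))).tendsto.comp
        hpath).mul_const
        (Real.Gamma δ : ℂ)
      have hconv := (continuousWithinAt_integral_rpow_mul_cexp h0 Complex.I hT.le).tendsto.comp
        (tendsto_nhdsWithin_iff.mpr ⟨hpath, hre.mono fun ε h => h.le⟩)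
      have hle := le_of_tendsto_of_tendsto (hpow.sub hconv).norm
        (tendsto_const_nhds.div hpath.norm (by simp))
        (hre.mono fun ε h => norm_Gamma_sub_integral_rpow_mul_cexp_le h0 h1 h hT)
      rw [norm_sub_rev]
      simpa using hle
    rw [tendsto_iff_norm_sub_tendsto_zero]
    have hdecay : Tendsto (fun T : ℝ => 2 * T ^ (δ - 1)) atTop (𝓝 0) := by
      simpa using (tendsto_rpow_neg_atTop (sub_pos.mpr h1)).const_mul 2
    refine squeeze_zero' (Eventually.of_forall fun T => norm_nonneg _) ?_ hdecay
    filter_upwards [eventually_gt_atTop 0] with T hT using hbound T hT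
  · rw [Complex.cpow_def_of_ne_zero Complex.I_ne_zero, Complex.log_I]
    congr 2
    ring
end
end

section
/- Let α > 0 be non-integer, let x₀ > 0, and set n = ⌊α⌋ + 2. Writing D^p(y^α) for the p-th derivative of y ↦ y^α (so D^p(y^α)(y) = α(α−1)⋯(α−p+1) y^(α−p)), one has Γ(α+1)/(2i)^(α+1) = ∫_0^{x₀} y^α e^(−2iy) dy + (2i)^(−n) ∫_{x₀}^∞ D^n(y^α)(y) e^(−2iy) dy + e^(−2ix₀) Σ_{p=0}^{n−1} (2i)^(−(p+1)) D^p(y^α)(x₀), where the integral over [x₀, ∞) converges absolutely. -/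
open MeasureTheory Set Filter Topology

noncomputable section

/-- `dcoef α p = α(α-1)⋯(α-p+1)`, the coefficient of the `p`-th derivative of `y^α`. -/
def dcoef (α : ℝ) (p : ℕ) : ℝ := ∏ j ∈ Finset.range p, (α - j)

theorem integrableOn_rpow_mul_cexp_neg_mul (s : ℝ) {r : ℂ} (hr : 0 < r.re) {a : ℝ} (ha : 0 < a) :
    IntegrableOn (fun y : ℝ => ((y ^ s : ℝ) : ℂ) * Complex.exp (-r * y)) (Ioi a) := by
  have hreal : IntegrableOn (fun y : ℝ => y ^ s * Real.exp (-r.re * y)) (Ioi a) := by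
    refine integrable_of_isBigO_exp_neg (b := r.re / 2) (by positivity) ?_ ?_
    · refine ContinuousOn.mul (fun y hy => ?_) (by fun_prop)
      exact (Real.continuousAt_rpow_const y s
        (Or.inl (ha.trans_le hy).ne')).continuousWithinAt
    · have h := (isLittleO_rpow_exp_pos_mul_atTop s (half_pos hr)).isBigO.mul
        (Asymptotics.isBigO_refl (fun y : ℝ => Real.exp (-r.re * y)) atTop)
      refine h.congr_right fun y => ?_
      rw [← Real.exp_add]
      ring_nf
  refine Integrable.mono' hreal ?_ ?_
  · refine Measurable.aestronglyMeasurable ?_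
    fun_prop
  · refine (ae_restrict_mem measurableSet_Ioi).mono fun y hy => ?_
    have hy0 : 0 < y := ha.trans hy
    rw [norm_mul, Complex.norm_exp, Complex.norm_real, Real.norm_of_nonneg (by positivity)]
    simp

theorem tendsto_rpow_mul_cexp_neg_mul (s : ℝ) {r : ℂ} (hr : 0 < r.re) :
    Tendsto (fun y : ℝ => ((y ^ s : ℝ) : ℂ) * Complex.exp (-r * y)) atTop (𝓝 0) := by
  rw [tendsto_zero_iff_norm_tendsto_zero]
  refine (tendsto_rpow_mul_exp_neg_mul_atTop_nhds_zero s r.re hr).congr' ?_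
  filter_upwards [eventually_gt_atTop 0] with y hy
  rw [norm_mul, Complex.norm_exp, Complex.norm_real, Real.norm_of_nonneg (by positivity)]
  simp

theorem integral_Ioi_rpow_mul_cexp_neg_mul (s : ℝ) {r : ℂ} (hr : 0 < r.re) {a : ℝ} (ha : 0 < a) :
    ∫ y in Ioi a, ((y ^ s : ℝ) : ℂ) * Complex.exp (-r * y) =
      r⁻¹ * (s * ∫ y in Ioi a, ((y ^ (s - 1) : ℝ) : ℂ) * Complex.exp (-r * y)) +
        r⁻¹ * (((a ^ s : ℝ) : ℂ) * Complex.exp (-r * a)) := by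
  have hr0 : r ≠ 0 := fun h => by simp [h] at hr
  have hint := fun t : ℝ => integrableOn_rpow_mul_cexp_neg_mul t hr ha
  have hderiv : ∀ y ∈ Ici a, HasDerivAt
      (fun y : ℝ => ((y ^ s : ℝ) : ℂ) * Complex.exp (-r * y))
      ((s : ℂ) * (((y ^ (s - 1) : ℝ) : ℂ) * Complex.exp (-r * y)) -
        r * (((y ^ s : ℝ) : ℂ) * Complex.exp (-r * y))) y := by
    intro y hy
    have h1 := (Real.hasDerivAt_rpow_const (p := s)
      (Or.inl (ha.trans_le hy).ne')).ofReal_comp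
    have h2 := (((hasDerivAt_id y).ofReal_comp).const_mul (-r)).cexp
    refine (h1.mul h2).congr_deriv ?_
    simp only [id, Complex.ofReal_mul, Complex.ofReal_one]
    ring
  have h := integral_Ioi_of_hasDerivAt_of_tendsto' hderiv
    (((hint (s - 1)).const_mul (s : ℂ)).sub ((hint s).const_mul r))
    (tendsto_rpow_mul_cexp_neg_mul s hr)
  rw [integral_sub ((hint (s - 1)).const_mul (s : ℂ)) ((hint s).const_mul r),
    integral_const_mul, integral_const_mul] at h
  rw [← mul_add, eq_inv_mul_iff_mul_eq₀ hr0]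
  linear_combination -h

theorem dcoef_succ (α : ℝ) (p : ℕ) : dcoef α (p + 1) = dcoef α p * (α - p) :=
  Finset.prod_range_succ _ _

theorem integral_Ioi_rpow_mul_cexp_neg_mul_eq_sum (α : ℝ) {r : ℂ} (hr : 0 < r.re) {a : ℝ}
    (ha : 0 < a) (n : ℕ) :
    ∫ y in Ioi a, ((y ^ α : ℝ) : ℂ) * Complex.exp (-r * y) =
      r ^ (-(n : ℤ)) * (∫ y in Ioi a, ((dcoef α n * y ^ (α - n) : ℝ) : ℂ) *
        Complex.exp (-r * y)) +
      Complex.exp (-r * a) * ∑ p ∈ Finset.range n,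
        r ^ (-(p : ℤ) - 1) * ((dcoef α p * a ^ (α - p) : ℝ) : ℂ) := by
  have hr0 : r ≠ 0 := fun h => by simp [h] at hr
  simp only [Complex.ofReal_mul, mul_assoc, integral_const_mul]
  induction n with
  | zero => simp [dcoef]
  | succ n ih =>
    rw [ih, integral_Ioi_rpow_mul_cexp_neg_mul (α - n) hr ha, Finset.sum_range_succ, dcoef_succ]
    have hz : r ^ (-((n + 1 : ℕ) : ℤ)) = r ^ (-(n : ℤ)) * r⁻¹ := by
      rw [← zpow_sub_one₀ hr0]; congr 1; push_cast; ring
    rw [hz, zpow_sub_one₀ hr0]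
    push_cast
    rw [← sub_sub]
    ring

theorem tendsto_setIntegral_mul_cexp_neg_mul {f : ℝ → ℂ} {S : Set ℝ} (hS : MeasurableSet S)
    (hS0 : S ⊆ Ioi 0) (hf : IntegrableOn f S) (c : ℝ) :
    Tendsto (fun ε : ℝ => ∫ y in S, f y * Complex.exp (-((ε : ℂ) + c * Complex.I) * y))
      (𝓝[>] 0) (𝓝 (∫ y in S, f y * Complex.exp (-(((0 : ℝ) : ℂ) + c * Complex.I) * y))) := by
  refine tendsto_integral_filter_of_dominated_convergence (fun y => ‖f y‖) ?_ ?_ hf.norm ?_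
  · refine Eventually.of_forall fun ε => hf.aestronglyMeasurable.mul ?_
    exact Continuous.aestronglyMeasurable (by fun_prop)
  · filter_upwards [self_mem_nhdsWithin] with ε hε
    refine (ae_restrict_mem hS).mono fun y hy => ?_
    rw [norm_mul, Complex.norm_exp]
    refine mul_le_of_le_one_right (norm_nonneg _) (Real.exp_le_one_iff.2 ?_)
    have := mul_pos (mem_Ioi.1 hε) (mem_Ioi.1 (hS0 hy))
    simpa using this.le
  · refine Eventually.of_forall fun y => Tendsto.mono_left ?_ nhdsWithin_le_nhds
    exact Continuous.tendsto (f := fun ε : ℝ =>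
      f y * Complex.exp (-((ε : ℂ) + c * Complex.I) * y)) (by fun_prop) 0

theorem differentiableAt_integral_Ioi_rpow_mul_cexp_neg_mul {s : ℝ} (hs : -1 < s) {r : ℂ}
    (hr : 0 < r.re) :
    DifferentiableAt ℂ
      (fun z : ℂ => ∫ y in Ioi (0 : ℝ), ((y ^ s : ℝ) : ℂ) * Complex.exp (-z * y)) r := by
  have hint : ∀ t : ℝ, -1 < t → ∀ b : ℝ, 0 < b →
      IntegrableOn (fun y : ℝ => y ^ t * Real.exp (-b * y)) (Ioi 0) := fun t ht b hb => by
    simpa using integrableOn_rpow_mul_exp_neg_mul_rpow ht one_pos hb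
  have hmeas : ∀ z : ℂ, AEStronglyMeasurable
      (fun y : ℝ => ((y ^ s : ℝ) : ℂ) * Complex.exp (-z * y)) (volume.restrict (Ioi 0)) :=
    fun z => Measurable.aestronglyMeasurable (by fun_prop)
  refine (hasDerivAt_integral_of_dominated_loc_of_deriv_le
    (F := fun (z : ℂ) (y : ℝ) => ((y ^ s : ℝ) : ℂ) * Complex.exp (-z * y))
    (F' := fun (z : ℂ) (y : ℝ) => ((y ^ s : ℝ) : ℂ) * (Complex.exp (-z * y) * (-y)))
    (bound := fun y : ℝ => y ^ (s + 1) * Real.exp (-(r.re / 2) * y))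
    (s := {z : ℂ | r.re / 2 < z.re})
    ((isOpen_lt continuous_const Complex.continuous_re).mem_nhds (half_lt_self hr))
    (Eventually.of_forall hmeas) ?_ ?_ ?_ (hint _ (by linarith) _ (half_pos hr))
    ?_).2.differentiableAt
  · refine Integrable.mono' (hint s hs _ hr) (hmeas r) ?_
    refine (ae_restrict_mem measurableSet_Ioi).mono fun y hy => ?_
    have hy0 : 0 < y := hy
    rw [norm_mul, Complex.norm_exp, Complex.norm_real, Real.norm_of_nonneg (by positivity)]
    simp
  · exact Measurable.aestronglyMeasurable (by fun_prop)
  · refine (ae_restrict_mem measurableSet_Ioi).mono fun y hy z hz => ?_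
    have hy0 : 0 < y := hy
    have hz' : r.re / 2 < z.re := hz
    rw [norm_mul, norm_mul, norm_neg, Complex.norm_exp, Complex.norm_real, Complex.norm_real,
      Real.norm_of_nonneg hy0.le, Real.norm_of_nonneg (by positivity), Real.rpow_add_one hy0.ne',
      mul_comm (Real.exp _), ← mul_assoc]
    gcongr
    simp only [Complex.mul_re, Complex.neg_re, Complex.ofReal_re, Complex.ofReal_im, mul_zero,
      sub_zero]
    gcongr
  · refine Eventually.of_forall fun y z _ => ?_
    have h := ((hasDerivAt_id z).neg.mul_const (y : ℂ)).cexp.const_mul ((y ^ s : ℝ) : ℂ)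
    simpa using h

theorem integral_Ioi_zero_rpow_mul_cexp_neg_mul {s : ℝ} (hs : -1 < s) {r : ℂ} (hr : 0 < r.re) :
    ∫ y in Ioi (0 : ℝ), ((y ^ s : ℝ) : ℂ) * Complex.exp (-r * y) =
      (Real.Gamma (s + 1) : ℂ) / r ^ ((s : ℂ) + 1) := by
  have hopen : IsOpen {z : ℂ | 0 < z.re} := isOpen_lt continuous_const Complex.continuous_re
  have hslit : ∀ z : ℂ, 0 < z.re → z ∈ Complex.slitPlane := fun z hz => Or.inl hz
  have hne : ∀ z : ℂ, 0 < z.re → z ^ ((s : ℂ) + 1) ≠ 0 := fun z hz h => by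
    rw [Complex.cpow_eq_zero_iff] at h
    simp [h.1] at hz
  have hl : AnalyticOnNhd ℂ
      (fun z : ℂ => ∫ y in Ioi (0 : ℝ), ((y ^ s : ℝ) : ℂ) * Complex.exp (-z * y))
      {z | 0 < z.re} :=
    DifferentiableOn.analyticOnNhd (fun z hz =>
      (differentiableAt_integral_Ioi_rpow_mul_cexp_neg_mul hs hz).differentiableWithinAt) hopen
  have hg : AnalyticOnNhd ℂ (fun z : ℂ => (Real.Gamma (s + 1) : ℂ) / z ^ ((s : ℂ) + 1))
      {z | 0 < z.re} :=
    DifferentiableOn.analyticOnNhd (fun z hz =>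
      ((differentiableAt_const _).div (differentiableAt_id.cpow_const (hslit z hz))
        (hne z hz)).differentiableWithinAt) hopen
  have hreal : ∀ x : ℝ, 0 < x →
      ∫ y in Ioi (0 : ℝ), ((y ^ s : ℝ) : ℂ) * Complex.exp (-(x : ℂ) * y) =
      (Real.Gamma (s + 1) : ℂ) / (x : ℂ) ^ ((s : ℂ) + 1) := fun x hx => by
    have h := Real.integral_rpow_mul_exp_neg_mul_Ioi (a := s + 1) (r := x) (by linarith) hx
    rw [add_sub_cancel_right, Real.div_rpow zero_le_one hx.le, Real.one_rpow] at h
    have h' := congrArg (fun t : ℝ => (t : ℂ)) h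
    simp only [← integral_complex_ofReal] at h'
    push_cast [Complex.ofReal_cpow hx.le] at h'
    rw [div_eq_mul_one_div, mul_comm, ← h']
    simp only [neg_mul]
  refine hl.eqOn_of_preconnected_of_frequently_eq hg
    (convex_halfSpace_re_gt 0).isPreconnected (z₀ := 1) (by simp) ?_ hr
  have hmap : Tendsto (fun x : ℝ => (x : ℂ)) (𝓝[≠] 1) (𝓝[≠] 1) := by
    refine tendsto_nhdsWithin_iff.2 ⟨?_, ?_⟩
    · simpa using (Complex.continuous_ofReal.tendsto 1).mono_left nhdsWithin_le_nhds
    · filter_upwards [self_mem_nhdsWithin] with x hx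
      simpa using hx
  refine hmap.frequently (Eventually.frequently ?_)
  filter_upwards [nhdsWithin_le_nhds (Ioi_mem_nhds one_pos)] with x hx
  exact hreal x hx

theorem Gamma_div_cpow_eq_integral_add_sum {α : ℝ} (hα : 0 < α) {r : ℂ} (hr : 0 < r.re) {a : ℝ}
    (ha : 0 < a) (n : ℕ) :
    (Real.Gamma (α + 1) : ℂ) / r ^ ((α : ℂ) + 1) =
      (∫ y in Ioc 0 a, ((y ^ α : ℝ) : ℂ) * Complex.exp (-r * y)) +
      r ^ (-(n : ℤ)) * (∫ y in Ioi a, ((dcoef α n * y ^ (α - n) : ℝ) : ℂ) *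
        Complex.exp (-r * y)) +
      Complex.exp (-r * a) * ∑ p ∈ Finset.range n,
        r ^ (-(p : ℤ) - 1) * ((dcoef α p * a ^ (α - p) : ℝ) : ℂ) := by
  rw [← integral_Ioi_zero_rpow_mul_cexp_neg_mul (by linarith) hr, add_assoc,
    ← integral_Ioi_rpow_mul_cexp_neg_mul_eq_sum α hr ha n, ← Ioc_union_Ioi_eq_Ioi ha.le,
    ← setIntegral_union (Ioc_disjoint_Ioi le_rfl) measurableSet_Ioi _
      (integrableOn_rpow_mul_cexp_neg_mul α hr ha), Ioc_union_Ioi_eq_Ioi ha.le]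
  refine (Continuous.integrableOn_Icc ?_).mono_set Ioc_subset_Icc_self
  exact (Complex.continuous_ofReal.comp (Real.continuous_rpow_const hα.le)).mul (by fun_prop)

/-- decomposition of `Γ(α+1)/(2i)^{α+1}` by repeated integration by parts. -/
theorem stmt19 (α x₀ : ℝ) (hα : 0 < α) (hni : ∀ m : ℕ, (m : ℝ) ≠ α) (hx₀ : 0 < x₀) :
    IntegrableOn
      (fun y : ℝ => ((dcoef α (Nat.floor α + 2) *
          y ^ (α - ((Nat.floor α : ℝ) + 2)) : ℝ) : ℂ) *
        Complex.exp (-2 * Complex.I * (y : ℂ))) (Ioi x₀) ∧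
    (Real.Gamma (α + 1) : ℂ) / (2 * Complex.I) ^ ((α : ℂ) + 1) =
      (∫ y in (0:ℝ)..x₀, ((y ^ α : ℝ) : ℂ) * Complex.exp (-2 * Complex.I * (y : ℂ))) +
        (2 * Complex.I) ^ (-((Nat.floor α : ℤ) + 2)) *
          (∫ y in Ioi x₀, ((dcoef α (Nat.floor α + 2) *
              y ^ (α - ((Nat.floor α : ℝ) + 2)) : ℝ) : ℂ) *
            Complex.exp (-2 * Complex.I * (y : ℂ))) +
        Complex.exp (-2 * Complex.I * (x₀ : ℂ)) *
          ∑ p ∈ Finset.range (Nat.floor α + 2),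
            (2 * Complex.I) ^ (-(p : ℤ) - 1) *
              ((dcoef α p * x₀ ^ (α - (p : ℝ)) : ℝ) : ℂ) := by
  set n := Nat.floor α + 2 with hn
  have hexp : α - ((Nat.floor α : ℝ) + 2) = α - n := by rw [hn]; push_cast; rfl
  have hzexp : -((Nat.floor α : ℤ) + 2) = -(n : ℤ) := by rw [hn]; push_cast; rfl
  have hlt : α - n < -1 := by
    have := Nat.lt_floor_add_one α
    rw [hn]; push_cast; linarith
  rw [hexp, hzexp]
  have htail : IntegrableOn (fun y : ℝ => ((dcoef α n * y ^ (α - n) : ℝ) : ℂ)) (Ioi x₀) :=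
    ((integrableOn_Ioi_rpow_of_lt hlt hx₀).const_mul _).ofReal
  have hhead : IntegrableOn (fun y : ℝ => ((y ^ α : ℝ) : ℂ)) (Ioc 0 x₀) :=
    (Complex.continuous_ofReal.comp
      (Real.continuous_rpow_const hα.le)).integrableOn_Icc.mono_set Ioc_subset_Icc_self
  refine ⟨?_, ?_⟩
  · refine Integrable.mono htail
      (htail.aestronglyMeasurable.mul (Continuous.aestronglyMeasurable (by fun_prop)))
      (Eventually.of_forall fun y => ?_)
    rw [norm_mul, Complex.norm_exp]
    simp
  have h2I : ((0 : ℝ) : ℂ) + ((2 : ℝ) : ℂ) * Complex.I = 2 * Complex.I := by simp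
  have h2I0 : (2 * Complex.I : ℂ) ≠ 0 := by simp
  have hr : Tendsto (fun ε : ℝ => (ε : ℂ) + ((2 : ℝ) : ℂ) * Complex.I) (𝓝[>] 0)
      (𝓝 (2 * Complex.I)) := by
    rw [← h2I]
    exact (Continuous.tendsto (f := fun ε : ℝ => (ε : ℂ) + ((2 : ℝ) : ℂ) * Complex.I)
      (by fun_prop) 0).mono_left nhdsWithin_le_nhds
  have hzpow (k : ℤ) := (continuousAt_zpow₀ (2 * Complex.I) k (Or.inl h2I0)).tendsto.comp hr
  have hLHS := (tendsto_const_nhds (x := (Real.Gamma (α + 1) : ℂ))).div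
    ((continuousAt_cpow_const (b := (α : ℂ) + 1)
      (show 2 * Complex.I ∈ Complex.slitPlane by simp [Complex.slitPlane])).tendsto.comp hr)
    (fun h => h2I0 ((Complex.cpow_eq_zero_iff _ _).1 h).1)
  have hRHS := ((tendsto_setIntegral_mul_cexp_neg_mul measurableSet_Ioc
      Ioc_subset_Ioi_self hhead 2).add
    ((hzpow (-(n : ℤ))).mul (tendsto_setIntegral_mul_cexp_neg_mul measurableSet_Ioi
      (Ioi_subset_Ioi hx₀.le) htail 2))).add
    (((hr.neg.mul_const (x₀ : ℂ)).cexp).mul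
      (tendsto_finsetSum (Finset.range n) fun p _ =>
        (hzpow (-(p : ℤ) - 1)).mul_const ((dcoef α p * x₀ ^ (α - p) : ℝ) : ℂ)))
  rw [h2I] at hRHS
  simp only [intervalIntegral.integral_of_le hx₀.le, neg_mul (2 : ℂ)]
  refine tendsto_nhds_unique (hLHS.congr' ?_) hRHS
  filter_upwards [self_mem_nhdsWithin] with ε hε
  exact Gamma_div_cpow_eq_integral_add_sum hα (by simpa using hε) hx₀ n
end
end
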